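/- Let Q be a finite quandle with at least four elements, and suppose the automorphism group Aut Q acts 3-transitively on Q (that is, any ordered triple of distinct elements can be mapped to any other such triple by an automorphism). Then Q is the trivial quandle: a ◃ b = b for all a, b ∈ Q. -/

import Mathlib

/-- A quandle: a set with a binary operation `◃` such that every translation
by a fixed element is bijective, the operation is self-distributive, and every
element is idempotent.  (We use the convention in which the acting element is
written on the left, so that the trivial quandle is `a ◃ b = b`.) -/
class Quandle' (Q : Type u) where
  act : Q → Q → Q
  act_bijective : ∀ a : Q, Function.Bijective (act a)
  act_distrib : ∀ a b c : Q, act a (act b c) = act (act a b) (act a c)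
  act_self : ∀ a : Q, act a a = a

infixl:65 " ◃ " => Quandle'.act

namespace Quandle'

/-- An automorphism of a quandle is a bijection preserving the operation. -/
def IsAut (Q : Type u) [Quandle' Q] (φ : Equiv.Perm Q) : Prop :=
  ∀ a b : Q, φ (a ◃ b) = φ a ◃ φ b

end Quandle'

open Quandle'

/-- A finite quandle with at least four elements whose automorphism group acts
`3`-transitively (any ordered triple of distinct elements can be carried to any
other by an automorphism) is trivial: `a ◃ b = b` for all `a`, `b`. -/
theorem quandle_three_transitive_aut_trivial (Q : Type) [Quandle' Q] [Fintype Q]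
    (hcard : 4 ≤ Fintype.card Q)
    (h3 : ∀ x₁ x₂ x₃ y₁ y₂ y₃ : Q, x₁ ≠ x₂ → x₁ ≠ x₃ → x₂ ≠ x₃ →
      y₁ ≠ y₂ → y₁ ≠ y₃ → y₂ ≠ y₃ →
      ∃ φ : Equiv.Perm Q, IsAut Q φ ∧ φ x₁ = y₁ ∧ φ x₂ = y₂ ∧ φ x₃ = y₃) :
    ∀ a b : Q, a ◃ b = b := by
  classical
  intro a b
  by_contra hb
  have hab : a ≠ b := by
    rintro rfl
    exact hb (act_self a)
  have hac : a ≠ a ◃ b := fun h =>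
    hab ((act_bijective a).injective ((act_self a).trans h))
  -- An automorphism fixing `a` and `b` fixes `a ◃ b`, but some fourth point is available.
  obtain ⟨x, hx⟩ : ∃ x, x ∉ ({a, b, a ◃ b} : Finset Q) := by
    by_contra! h
    have hle : Fintype.card Q ≤ ({a, b, a ◃ b} : Finset Q).card :=
      Finset.card_le_card fun y _ => h y
    have := Finset.card_le_three (a := a) (b := b) (c := a ◃ b)
    omega
  simp only [Finset.mem_insert, Finset.mem_singleton, not_or] at hx
  obtain ⟨hxa, hxb, hxc⟩ := hx
  obtain ⟨φ, hφ, ha, hb', hc⟩ :=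
    h3 a b (a ◃ b) a b x hab hac (Ne.symm hb) hab (Ne.symm hxa) (Ne.symm hxb)
  rw [hφ, ha, hb'] at hc
  exact hxc hc.symm
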